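/- For every real number α with −1 < α < 1, the cellular automaton Ψ is pre-expansive in direction α. In particular (taking α = 0), Ψ is pre-expansive. -/

import Mathlib

/-- The CA `Ψ` on `(ℤ/3ℤ × ℤ/3ℤ)^ℤ`, the second-order construction applied to the
linear CA `F₃(c)(z) = c(z−1) + c(z+1)` over `ℤ/3ℤ`:
`Ψ(e)(z) = (e₂(z), e₁(z) + e₂(z−1) + e₂(z+1))`. -/
def psi : (ℤ → ZMod 3 × ZMod 3) → ℤ → ZMod 3 × ZMod 3 :=
  fun e z => ((e z).2, (e z).1 + (e (z - 1)).2 + (e (z + 1)).2)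

/-- Pre-expansivity in direction `α`. -/
def PreExpansiveDir (F : (ℤ → ZMod 3 × ZMod 3) → ℤ → ZMod 3 × ZMod 3) (α : ℝ) : Prop :=
  ∃ m : ℕ, ∀ c d : ℤ → ZMod 3 × ZMod 3, {z | c z ≠ d z}.Finite → c ≠ d →
    ∃ t : ℕ, ∃ x : ℤ, |x| ≤ (m : ℤ) ∧
      F^[t] c (⌈α * t⌉ + x) ≠ F^[t] d (⌈α * t⌉ + x)

/-- If `f (t + 1) + f t` is antiperiodic with odd antiperiod `p` in characteristic three, then `f`
is antiperiodic with antiperiod `3 * p`. -/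
lemma antiperiodic_three_mul_of_add_shift {f : ℕ → ZMod 3} {p : ℕ} (hp : Odd p)
    (h : Function.Antiperiodic (fun t => f (t + 1) + f t) p) :
    Function.Antiperiodic f (3 * p) := by
  have three : (3 : ZMod 3) = 0 := rfl
  have hs : ∀ n t, f (t + n + p) + f (t + n) = (-1) ^ n * (f (t + p) + f t) := by
    intro n
    induction n with
    | zero => simp
    | succ n ih =>
      intro t
      have h1 := h (t + n)
      simp only at h1
      rw [pow_succ, show t + (n + 1) + p = t + n + p + 1 by ring, ← add_assoc]
      linear_combination h1 - ih t
  intro t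
  have h1 := hs p t
  have h2 := hs (p + p) t
  rw [hp.neg_one_pow] at h1
  rw [Even.neg_one_pow ⟨p, rfl⟩] at h2
  rw [show t + 3 * p = t + (p + p) + p by ring]
  rw [← add_assoc] at h2 ⊢
  linear_combination h2 - h1 + (f (t + p) + f t) * three

section Blob

variable {b : ℕ → ℕ → ZMod 3}

lemma exists_odd_antiperiodic
    (hb : ∀ j t, b j (t + 2) = b (j + 2) t + b j (t + 1) + b (j + 2) (t + 1))
    (h0 : ∀ t, b 0 t = 0) (h1 : ∀ t, b 1 t = 0) (j : ℕ) :
    ∃ p, Odd p ∧ Function.Antiperiodic (b j) p := by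
  induction j using Nat.twoStepInduction with
  | zero => exact ⟨1, odd_one, fun t => by simp [h0]⟩
  | one => exact ⟨1, odd_one, fun t => by simp [h1]⟩
  | more j ih _ =>
    obtain ⟨p, hp, hap⟩ := ih
    refine ⟨3 * p, Odd.mul (by decide) hp, antiperiodic_three_mul_of_add_shift hp fun t => ?_⟩
    have e1 := hb j t
    have e2 := hb j (t + p)
    have e3 := hap (t + 1)
    have e4 := hap (t + 2)
    rw [show t + 1 + p = t + p + 1 by ring] at e3
    rw [show t + 2 + p = t + p + 2 by ring] at e4
    linear_combination e4 - e3 - e2 - e1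

lemma eventually_eq_zero_of_bounded
    (hb : ∀ j t, b j (t + 2) = b (j + 2) t + b j (t + 1) + b (j + 2) (t + 1))
    (h0 : ∀ t, b 0 t = 0) (h1 : ∀ t, b 1 t = 0) {M : ℕ} (hM : ∀ j t, M ≤ j → b j t = 0) :
    ∃ T, ∀ t ≥ T, ∀ j, b j t = 0 := by
  suffices H : ∀ n, ∃ T, ∀ t ≥ T, ∀ j, M ≤ j + n → b j t = 0 by
    obtain ⟨T, hT⟩ := H M
    exact ⟨T, fun t ht j => hT t ht j (by omega)⟩
  intro n
  induction n with
  | zero => exact ⟨0, fun t _ j hj => hM j t hj⟩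
  | succ n ih =>
    obtain ⟨T, hT⟩ := ih
    refine ⟨T + 1, fun t ht j hj => ?_⟩
    have hconst : ∀ k, b j (t + k) = b j t := by
      intro k
      induction k with
      | zero => rfl
      | succ k ihk =>
        have e := hb j (t + k - 1)
        rw [hT _ (by omega) (j + 2) (by omega), hT _ (by omega) (j + 2) (by omega),
          show t + k - 1 + 2 = t + (k + 1) by omega, show t + k - 1 + 1 = t + k by omega, ihk] at e
        simpa using e
    obtain ⟨p, -, hap⟩ := exists_odd_antiperiodic hb h0 h1 j
    have e := hap t
    rw [hconst] at e
    generalize b j t = x at e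
    revert e
    revert x
    decide

end Blob

section SpaceTime

variable {a : ℕ → ℤ → ZMod 3}

lemma eq_zero_of_strip_right
    (ha : ∀ t z, a (t + 2) z = a t z + a (t + 1) (z - 1) + a (t + 1) (z + 1))
    {α : ℝ} (h₁ : -1 < α) (h₂ : α < 1)
    (hs : ∀ (t : ℕ) (z : ℤ), |(z : ℝ) - α * t| ≤ 2 → a t z = 0)
    (t : ℕ) (z : ℤ) (hz : α * t ≤ z) (hzt : z ≤ t) : a t z = 0 := by
  obtain ⟨ε, hε, hε₁, hε₂⟩ : ∃ ε : ℝ, 0 < ε ∧ α ≤ 1 - ε ∧ -α ≤ 1 - ε :=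
    ⟨min (1 - α) (1 + α), lt_min (by linarith) (by linarith),
      by linarith [min_le_left (1 - α) (1 + α)], by linarith [min_le_right (1 - α) (1 + α)]⟩
  suffices H : ∀ (n : ℕ) (t : ℕ) (z : ℤ), α * t ≤ z → z ≤ t → z - α * t ≤ 2 + n * ε →
      a t z = 0 by
    obtain ⟨n, hn⟩ := exists_nat_gt (((z : ℝ) - α * t) / ε)
    rw [div_lt_iff₀ hε] at hn
    exact H n t z hz hzt (by linarith)
  intro n
  induction n with
  | zero =>
    intro t z hz _ hb
    simp only [Nat.cast_zero, zero_mul, add_zero] at hb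
    exact hs t z (abs_le.2 ⟨by linarith, hb⟩)
  | succ n ih =>
    intro t z hz hzt hb
    rcases le_or_gt ((z : ℝ) - α * t) 2 with h | h
    · exact hs t z (abs_le.2 ⟨by linarith, h⟩)
    have hztR : (z : ℝ) ≤ t := by exact_mod_cast hzt
    have ht : t ≠ 0 := by
      rintro rfl
      simp only [Nat.cast_zero, mul_zero, sub_zero] at h hztR
      linarith
    obtain ⟨s, rfl⟩ := Nat.exists_eq_succ_of_ne_zero ht
    have e := ha s (z - 1)
    push_cast at hzt hb h hz
    rw [ih (s + 2) (z - 1) (by push_cast; linarith) (by push_cast; linarith)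
        (by push_cast; linarith),
      ih s (z - 1) (by push_cast; linarith) (by linarith) (by push_cast; linarith),
      ih (s + 1) (z - 1 - 1) (by push_cast; linarith) (by push_cast; linarith)
        (by push_cast; linarith), sub_add_cancel] at e
    simpa using e.symm

lemma eq_zero_of_lt_right
    (ha : ∀ t z, a (t + 2) z = a t z + a (t + 1) (z - 1) + a (t + 1) (z + 1))
    {N : ℕ} (h0 : ∀ z : ℤ, N < z → a 0 z = 0) (h1 : ∀ z : ℤ, N < z → a 1 z = 0)
    (t : ℕ) (z : ℤ) (hz : N + t < z) : a t z = 0 := by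
  induction t using Nat.twoStepInduction generalizing z with
  | zero => exact h0 z (by omega)
  | one => exact h1 z (by omega)
  | more t ih ih' =>
    rw [ha, ih _ (by omega), ih' _ (by omega), ih' _ (by omega)]
    simp

lemma eventually_eq_zero_right
    (ha : ∀ t z, a (t + 2) z = a t z + a (t + 1) (z - 1) + a (t + 1) (z + 1))
    {N : ℕ} (h0 : ∀ z : ℤ, N < z → a 0 z = 0) (h1 : ∀ z : ℤ, N < z → a 1 z = 0)
    (hc : ∀ (t : ℕ) (z : ℤ), |z| ≤ t → a t z = 0) :
    ∃ T, ∀ t ≥ T, ∀ z : ℤ, 0 ≤ z → a t z = 0 := by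
  obtain ⟨T, hT⟩ := eventually_eq_zero_of_bounded (b := fun j t => a (t + 1) (t + j)) (M := N + 2)
    (fun j t => by
      rw [show t + 2 + 1 = t + 1 + 2 by ring, ha]
      push_cast
      ring_nf)
    (fun t => hc _ _ (abs_le.2 ⟨by omega, by omega⟩))
    (fun t => hc _ _ (abs_le.2 ⟨by omega, by omega⟩))
    (fun j t hj => eq_zero_of_lt_right ha h0 h1 _ _ (by omega))
  refine ⟨T + 1, fun t ht z hz => ?_⟩
  obtain ⟨s, rfl⟩ : ∃ s, t = s + 1 := ⟨t - 1, by omega⟩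
  rcases le_or_gt z s with h | h
  · exact hc _ _ (abs_le.2 ⟨by omega, by omega⟩)
  · have e := hT s (by omega) (z - s).toNat
    rwa [show (s : ℤ) + (z - s).toNat = z by omega] at e

lemma eq_zero_of_eq_zero_ge
    (ha : ∀ t z, a (t + 2) z = a t z + a (t + 1) (z - 1) + a (t + 1) (z + 1))
    {T : ℕ} (hT : ∀ t ≥ T, ∀ z, a t z = 0) (t : ℕ) (z : ℤ) : a t z = 0 := by
  induction T with
  | zero => exact hT t t.zero_le z
  | succ T ih =>
    refine ih fun t ht z => ?_
    have e := ha t z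
    rw [hT (t + 2) (by omega), hT (t + 1) (by omega), hT (t + 1) (by omega)] at e
    simpa using e.symm

/-- A space-time diagram with finite initial support that vanishes on a strip of slope
`α ∈ (-1, 1)` vanishes identically. -/
lemma eq_zero_of_strip
    (ha : ∀ t z, a (t + 2) z = a t z + a (t + 1) (z - 1) + a (t + 1) (z + 1))
    {N : ℕ} (h0 : ∀ z : ℤ, N < |z| → a 0 z = 0) (h1 : ∀ z : ℤ, N < |z| → a 1 z = 0)
    {α : ℝ} (h₁ : -1 < α) (h₂ : α < 1)
    (hs : ∀ (t : ℕ) (z : ℤ), |(z : ℝ) - α * t| ≤ 2 → a t z = 0)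
    (t : ℕ) (z : ℤ) : a t z = 0 := by
  have ha' : ∀ t z, a (t + 2) (-z) = a t (-z) + a (t + 1) (-(z - 1)) + a (t + 1) (-(z + 1)) := by
    intro t z
    rw [ha, show -(z - 1) = -z + 1 by ring, show -(z + 1) = -z - 1 by ring]
    ring
  have hc : ∀ (t : ℕ) (z : ℤ), |z| ≤ t → a t z = 0 := by
    intro t z hz
    have hz' := abs_le.1 hz
    rcases le_total (α * t) z with h | h
    · exact eq_zero_of_strip_right ha h₁ h₂ hs t z h hz'.2
    · have e := eq_zero_of_strip_right (a := fun t z => a t (-z)) ha' (α := -α) (by linarith)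
        (by linarith) (fun t z h => hs t (-z) (by
          rw [← abs_neg]
          convert h using 2
          push_cast
          ring)) t (-z) (by push_cast; linarith) (by omega)
      simpa using e
  obtain ⟨T₁, hT₁⟩ := eventually_eq_zero_right ha
    (fun z hz => h0 z (lt_of_lt_of_le hz (le_abs_self z)))
    (fun z hz => h1 z (lt_of_lt_of_le hz (le_abs_self z))) hc
  obtain ⟨T₂, hT₂⟩ := eventually_eq_zero_right (a := fun t z => a t (-z)) ha'
    (fun z hz => h0 _ (lt_of_lt_of_le hz (by rw [abs_neg]; exact le_abs_self z)))
    (fun z hz => h1 _ (lt_of_lt_of_le hz (by rw [abs_neg]; exact le_abs_self z)))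
    (fun t z hz => hc t (-z) (by rwa [abs_neg]))
  refine eq_zero_of_eq_zero_ge ha (T := max T₁ T₂) (fun t ht z => ?_) t z
  rcases le_total 0 z with h | h
  · exact hT₁ t (le_of_max_le_left ht) z h
  · simpa using hT₂ t (le_of_max_le_right ht) (-z) (by omega)

end SpaceTime

lemma preExpansiveDir_psi {α : ℝ} (h₁ : -1 < α) (h₂ : α < 1) : PreExpansiveDir psi α := by
  refine ⟨3, fun c d hfin hne => ?_⟩
  by_contra! H
  have hfst : ∀ (e : ℤ → ZMod 3 × ZMod 3) t z, (psi^[t + 1] e z).1 = (psi^[t] e z).2 := by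
    intro e t z
    rw [Function.iterate_succ_apply']
    rfl
  have hrec : ∀ (e : ℤ → ZMod 3 × ZMod 3) t z, (psi^[t + 2] e z).1 =
      (psi^[t] e z).1 + (psi^[t + 1] e (z - 1)).1 + (psi^[t + 1] e (z + 1)).1 := by
    intro e t z
    rw [hfst e (t + 1), hfst, hfst, Function.iterate_succ_apply']
    rfl
  obtain ⟨N, hN⟩ : ∃ N : ℕ, ∀ z : ℤ, N < |z| → c z = d z := by
    obtain ⟨N, hN⟩ := (hfin.image Int.natAbs).bddAbove
    refine ⟨N, fun z hz => ?_⟩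
    by_contra h
    have : z.natAbs ≤ N := hN ⟨z, h, rfl⟩
    rw [Int.abs_eq_natAbs] at hz
    omega
  have key := eq_zero_of_strip (a := fun t z => (psi^[t] c z).1 - (psi^[t] d z).1) (N := N)
    (fun t z => by simp only [hrec]; ring)
    (fun z hz => by simp [hN z hz]) (fun z hz => by
      rw [sub_eq_zero, hfst c 0, hfst d 0]
      simp [hN z hz]) h₁ h₂ (fun t z hz => by
      have hx : |z - ⌈α * t⌉| ≤ ((3 : ℕ) : ℤ) := by
        have hle := Int.le_ceil (α * t)
        have hlt := Int.ceil_lt_add_one (α * t)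
        obtain ⟨hl, hu⟩ := abs_le.1 hz
        have hR : |(z : ℝ) - ⌈α * t⌉| ≤ 3 := abs_le.2 ⟨by linarith, by linarith⟩
        exact_mod_cast hR
      have e := H t _ hx
      rw [add_sub_cancel] at e
      rw [e, sub_self])
  refine hne (funext fun z => Prod.ext (sub_eq_zero.1 (key 0 z)) ?_)
  have e := sub_eq_zero.1 (key 1 z)
  rwa [hfst c 0, hfst d 0] at e

/-- `Ψ` is pre-expansive in every direction `α ∈ (−1, 1)`;
in particular (direction `0`) it is pre-expansive. -/
theorem psi_preexpansive :
    (∀ α : ℝ, -1 < α → α < 1 → PreExpansiveDir psi α) ∧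
    (∃ m : ℕ, ∀ c d : ℤ → ZMod 3 × ZMod 3, {z | c z ≠ d z}.Finite → c ≠ d →
      ∃ t : ℕ, ∃ x : ℤ, |x| ≤ (m : ℤ) ∧ psi^[t] c x ≠ psi^[t] d x) := by
  refine ⟨fun α => preExpansiveDir_psi, ?_⟩
  simpa [PreExpansiveDir] using preExpansiveDir_psi (α := 0) (by norm_num) (by norm_num)
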